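/- Assume in addition that F is C² with F′ > 0. Then there is a constant C > 0 such that l_{n+m} ≤ C λᵐ lₙ for all n, m ∈ ℕ, where λ = 1/√(1 + e^{−𝒞}) ∈ (1/2, 1) and 𝒞 = ∫₀¹ |F″(x)/F′(x)| dx is the total variation of log F′ over one period. -/

import Mathlib

open Function in
/-- Summing a `q`-periodic function along an arithmetic progression whose step is coprime to `q`. -/
theorem sum_range_mul_add_of_periodic {E : Type*} [AddCommMonoid E] {f : ℤ → E} {q : ℕ}
    (hq : 0 < q) (hf : Periodic f (q : ℤ)) {p : ℤ} (hpq : IsCoprime p (q : ℤ)) (b : ℤ) :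
    ∑ i ∈ Finset.range q, f (i * p + b) = ∑ j ∈ Finset.range q, f j := by
  have hq' : (0 : ℤ) < q := by exact_mod_cast hq
  have hf_mod : ∀ r : ℤ, f (r % q) = f r := fun r => by
    conv_rhs => rw [← Int.emod_add_mul_ediv r q, mul_comm]
    simpa using (hf.int_mul (r / q) (r % q)).symm
  have hmaps : ∀ i ∈ Finset.range q, (((i : ℤ) * p + b) % q).toNat ∈ Finset.range q := by
    intro i _
    have h1 := Int.emod_lt_of_pos ((i : ℤ) * p + b) hq'
    have h2 := Int.emod_nonneg ((i : ℤ) * p + b) hq'.ne'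
    simp only [Finset.mem_range]
    omega
  have hinj : Set.InjOn (fun i : ℕ => (((i : ℤ) * p + b) % q).toNat) (Finset.range q) := by
    intro i hi j hj hij
    have h1 := Int.emod_nonneg ((i : ℤ) * p + b) hq'.ne'
    have h2 := Int.emod_nonneg ((j : ℤ) * p + b) hq'.ne'
    have h3 : ((i : ℤ) * p + b) % q = ((j : ℤ) * p + b) % q := by
      simp only at hij; omega
    have h4 : (q : ℤ) ∣ ((i : ℤ) - j) * p := by
      have := Int.ModEq.dvd (show (j : ℤ) * p + b ≡ (i : ℤ) * p + b [ZMOD q] from h3.symm)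
      convert! this using 1
      ring
    have h5 : (q : ℤ) ∣ (i : ℤ) - j := hpq.symm.dvd_of_dvd_mul_right h4
    have hi' : (i : ℤ) < q := by exact_mod_cast Finset.mem_range.1 hi
    have hj' : (j : ℤ) < q := by exact_mod_cast Finset.mem_range.1 hj
    have := Int.eq_zero_of_abs_lt_dvd h5 (by rw [abs_lt]; omega)
    omega
  refine Finset.sum_nbij (fun i : ℕ => (((i : ℤ) * p + b) % q).toNat) hmaps hinj
    (Finset.surjOn_of_injOn_of_card_le _ hmaps hinj le_rfl) fun i _ => ?_
  rw [Int.toNat_of_nonneg (Int.emod_nonneg _ hq'.ne'), hf_mod]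

/-- `y` separates the values of the monotone function `H` to the left of `s` from those to the
right of `s`. -/
def Straddles (H : ℝ → ℝ) (s y : ℝ) : Prop :=
  (∀ u < s, H u ≤ y) ∧ ∀ u > s, y ≤ H u

namespace Straddles

variable {H : ℝ → ℝ} {s t y z : ℝ}

theorem of_monotone (hH : Monotone H) (s : ℝ) : Straddles H s (H s) :=
  ⟨fun _ hu => hH hu.le, fun _ hu => hH (le_of_lt hu)⟩

theorem le (hs : Straddles H s y) (ht : Straddles H t z) (hst : s < t) : y ≤ z := by
  obtain ⟨u, hsu, hut⟩ := exists_between hst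
  exact (hs.2 u hsu).trans (ht.1 u hut)

/-- A semiconjugacy from a translation to a monotone map transports straddling points. -/
theorem map {f : ℝ → ℝ} (hf : Monotone f) {c : ℝ} (hHf : ∀ u, H (u + c) = f (H u))
    (hs : Straddles H s y) : Straddles H (s + c) (f y) := by
  refine ⟨fun u hu => ?_, fun u hu => ?_⟩
  · have := hHf (u - c)
    rw [sub_add_cancel] at this
    exact this ▸ hf (hs.1 _ (by linarith))
  · have := hHf (u - c)
    rw [sub_add_cancel] at this
    exact this ▸ hf (hs.2 _ (by linarith))

theorem iterate {f : ℝ → ℝ} (hf : Monotone f) {c : ℝ} (hHf : ∀ u, H (u + c) = f (H u))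
    (hs : Straddles H s y) (n : ℕ) : Straddles H (s + n * c) (f^[n] y) := by
  induction n with
  | zero => simpa using hs
  | succ n ih =>
    rw [Function.iterate_succ_apply']
    convert! ih.map hf hHf using 1
    push_cast
    ring

end Straddles

theorem CircleDeg1Lift.exists_straddles (H : CircleDeg1Lift) (y : ℝ) : ∃ s, Straddles H s y := by
  have hne : {t | H t ≤ y}.Nonempty := (H.tendsto_atBot.eventually_le_atBot y).exists
  have hbdd : BddAbove {t | H t ≤ y} := by
    obtain ⟨b, hb⟩ := (H.tendsto_atTop.eventually_gt_atTop y).exists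
    exact ⟨b, fun t ht => le_of_not_gt fun hbt => (hb.trans_le (H.monotone hbt.le)).not_ge ht⟩
  refine ⟨sSup {t | H t ≤ y}, fun u hu => ?_, fun u hu => ?_⟩
  · obtain ⟨t, ht, hut⟩ := exists_lt_of_lt_csSup hne hu
    exact (H.monotone hut.le).trans ht
  · by_contra! h
    exact (le_csSup hbdd h.le).not_gt hu

theorem abs_sub_le_integral_abs_deriv {φ g : ℝ → ℝ} (hφ : ∀ x, HasDerivAt φ (g x) x)
    (hg : Continuous g) {c d y z : ℝ} (hy : y ∈ Set.Icc c d) (hz : z ∈ Set.Icc c d) :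
    |φ y - φ z| ≤ ∫ x in c..d, |g x| := by
  rw [← intervalIntegral.integral_eq_sub_of_hasDerivAt (fun x _ => hφ x)
    (hg.intervalIntegrable _ _)]
  have hint : ∀ a b, IntervalIntegrable (fun x => |g x|) MeasureTheory.volume a b :=
    fun a b => hg.abs.intervalIntegrable a b
  have key : ∀ a ∈ Set.Icc c d, ∀ b ∈ Set.Icc c d, a ≤ b →
      |∫ x in a..b, g x| ≤ ∫ x in c..d, |g x| := fun a ha b hb hab =>
    (intervalIntegral.abs_integral_le_integral_abs hab).trans <|
      intervalIntegral.integral_mono_interval ha.1 hab hb.2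
        (Filter.Eventually.of_forall fun x => abs_nonneg _) (hint _ _)
  rcases le_total z y with h | h
  · exact key z hz y hy h
  · rw [intervalIntegral.integral_symm, abs_neg]
    exact key y hy z hz h

theorem Monotone.intervalIntegrable_continuous_comp {H φ : ℝ → ℝ} (hH : Monotone H)
    (hφ : Continuous φ) (a b : ℝ) :
    IntervalIntegrable (fun t => φ (H t)) MeasureTheory.volume a b := by
  rw [intervalIntegrable_iff]
  obtain ⟨M, hM⟩ := (isCompact_Icc (a := H (min a b)) (b := H (max a b))).exists_bound_of_continuousOn
    hφ.continuousOn
  refine MeasureTheory.Measure.integrableOn_of_bounded (M := M) (by simp [Set.uIoc])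
    (hφ.measurable.comp hH.measurable).aestronglyMeasurable ?_
  rw [MeasureTheory.ae_restrict_iff' measurableSet_uIoc]
  exact Filter.Eventually.of_forall fun t ht => hM _ ⟨hH ht.1.le, hH ht.2⟩

theorem abs_sub_mul_integral_comp_le {H φ g : ℝ → ℝ} (hH : Monotone H)
    (hφ : ∀ x, HasDerivAt φ (g x) x) (hg : Continuous g) {q s t c d y : ℝ} (hq : 0 < q)
    (hst : q * (t - s) = 1) (hy : y ∈ Set.Icc c d)
    (hHcd : ∀ u, s < u → u < t → H u ∈ Set.Icc c d) :
    |φ y - q * ∫ u in s..t, φ (H u)| ≤ ∫ x in c..d, |g x| := by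
  have hφc : Continuous φ := continuous_iff_continuousAt.2 fun x => (hφ x).continuousAt
  have hst' : s < t := by
    by_contra! h
    nlinarith
  have hsplit : φ y - q * ∫ u in s..t, φ (H u) = q * ∫ u in s..t, (φ y - φ (H u)) := by
    rw [intervalIntegral.integral_sub (by simp)
      (hH.intervalIntegrable_continuous_comp hφc _ _), intervalIntegral.integral_const, smul_eq_mul,
      mul_sub, ← mul_assoc, hst, one_mul]
  have hbound : ‖∫ u in s..t, (φ y - φ (H u))‖ ≤ (∫ x in c..d, |g x|) * |t - s| := by
    refine intervalIntegral.norm_integral_le_of_norm_le_const_ae ?_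
    filter_upwards [MeasureTheory.compl_mem_ae_iff.2 (MeasureTheory.measure_singleton t)]
      with u hut hu
    rw [Set.uIoc_of_le hst'.le] at hu
    exact abs_sub_le_integral_abs_deriv hφ hg hy (hHcd u hu.1 (lt_of_le_of_ne hu.2 hut))
  rw [Real.norm_eq_abs, abs_of_pos (sub_pos.2 hst')] at hbound
  rw [hsplit, abs_mul, abs_of_pos hq]
  calc q * |∫ u in s..t, (φ y - φ (H u))| ≤ q * ((∫ x in c..d, |g x|) * (t - s)) := by gcongr
    _ = ∫ x in c..d, |g x| := by linear_combination (∫ x in c..d, |g x|) * hst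

/-- A point `x` and a straddling parameter `s` for it extend to a family of points straddling the
grid `s + r / q`. -/
theorem CircleDeg1Lift.exists_straddling_grid (H : CircleDeg1Lift) {q : ℕ} (hq : 0 < q) {s x : ℝ}
    (hs : Straddles H s x) :
    ∃ c : ℤ → ℝ, c 0 = x ∧ (∀ r : ℤ, c (r + q) = c r + 1) ∧
      ∀ r : ℤ, Straddles H (s + r / q) (c r) := by
  have hq' : (q : ℝ) ≠ 0 := by positivity
  classical
  refine ⟨fun r => if (q : ℤ) ∣ r then x + r / q else H (s + r / q), by simp, fun r => ?_,
    fun r => ?_⟩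
  · have h : (((r + q : ℤ) : ℝ)) / q = r / q + 1 := by
      push_cast
      field_simp
    simp only [dvd_add_self_right, h, ← add_assoc, H.map_add_one]
    split_ifs <;> rfl
  · dsimp only
    split_ifs with h
    · obtain ⟨m, rfl⟩ := h
      have h : (((q * m : ℤ) : ℝ)) / q = m := by
        push_cast
        field_simp
      rw [h]
      exact hs.map (f := fun u => u + m) (fun _ _ h => by simpa using h) fun u => H.map_add_int u m
    · exact .of_monotone H.monotone _

open Function in
/-- The **Denjoy–Koksma inequality** for a circle map `f` semiconjugate to a rotation. -/
theorem CircleDeg1Lift.abs_birkhoffSum_sub_le (f H : CircleDeg1Lift) {ρ : ℝ}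
    (hHf : ∀ t, H (t + ρ) = f (H t)) {φ g : ℝ → ℝ} (hφ : ∀ x, HasDerivAt φ (g x) x)
    (hg : Continuous g) (hφ1 : Periodic φ 1) (hg1 : Periodic g 1) {q : ℕ} (hq : 0 < q)
    {p b : ℤ} (hpq : IsCoprime p (q : ℤ)) (hb : b = 0 ∨ b = -1)
    (hρ : ∀ i : ℕ, 0 < i → i < q →
      ((i * p + b : ℤ) : ℝ) / q < i * ρ ∧ i * ρ < ((i * p + b + 1 : ℤ) : ℝ) / q) (x : ℝ) :
    |birkhoffSum f φ q x - q * ∫ t in (0 : ℝ)..1, φ (H t)| ≤ ∫ t in (0 : ℝ)..1, |g t| := by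
  have hq' : (0 : ℝ) < q := by exact_mod_cast hq
  obtain ⟨s, hs⟩ := H.exists_straddles x
  obtain ⟨c, hc0, hcq, hc⟩ := H.exists_straddling_grid hq hs
  have hgrid : ∀ {r r' : ℤ}, r < r' → s + (r : ℝ) / q < s + (r' : ℝ) / q := fun h => by gcongr
  have hc_le : ∀ r, c r ≤ c (r + 1) := fun r => (hc r).le (hc (r + 1)) (hgrid (lt_add_one r))
  have hφc : Continuous φ := continuous_iff_continuousAt.2 fun x => (hφ x).continuousAt
  set I : ℤ → ℝ := fun r => ∫ t in (s + (r : ℝ) / q)..(s + ((r + 1 : ℤ) : ℝ) / q), φ (H t) with hI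
  set W : ℤ → ℝ := fun r => ∫ t in (c r)..(c (r + 1)), |g t| with hW
  have hIper : Periodic I (q : ℤ) := fun r => by
    have h1 : s + ((r + q : ℤ) : ℝ) / q = s + (r : ℝ) / q + 1 := by
      push_cast; field_simp; ring
    have h2 : s + ((r + q + 1 : ℤ) : ℝ) / q = s + ((r + 1 : ℤ) : ℝ) / q + 1 := by
      push_cast; field_simp; ring
    simp only [hI, h1, h2]
    rw [← intervalIntegral.integral_comp_add_right]
    simp only [H.map_add_one, hφ1 _]
  have hWper : Periodic W (q : ℤ) := fun r => by
    simp only [hW, hcq, add_right_comm r (q : ℤ) 1]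
    rw [← intervalIntegral.integral_comp_add_right (fun t => |g t|)]
    simp only [hg1 _]
  have hIsum : ∑ j ∈ Finset.range q, I j = ∫ t in (0 : ℝ)..1, φ (H t) := by
    have h1 := intervalIntegral.sum_integral_adjacent_intervals (n := q) (f := fun t => φ (H t))
      (a := fun j : ℕ => s + (j : ℝ) / q) (μ := MeasureTheory.volume)
      fun j _ => H.monotone.intervalIntegrable_continuous_comp hφc _ _
    have hper : Periodic (fun t => φ (H t)) 1 := fun t => by simp only [H.map_add_one, hφ1 _]
    have h2 := hper.intervalIntegral_add_eq s 0
    simp only [Nat.cast_zero, zero_div, add_zero, div_self hq'.ne', zero_add] at h1 h2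
    rw [← h2, ← h1]
    exact Finset.sum_congr rfl fun j _ => by simp [hI]
  have hWsum : ∑ j ∈ Finset.range q, W j = ∫ t in (0 : ℝ)..1, |g t| := by
    have h1 := intervalIntegral.sum_integral_adjacent_intervals (n := q) (f := fun t => |g t|)
      (a := fun j : ℕ => c j) (μ := MeasureTheory.volume)
      fun j _ => hg.abs.intervalIntegrable _ _
    have hper : Periodic (fun t => |g t|) 1 := fun t => by simp only [hg1 _]
    have h2 := hper.intervalIntegral_add_eq x 0
    have h3 := hcq 0
    rw [zero_add] at h2 h3
    simp only [Nat.cast_zero, h3, hc0] at h1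
    rw [← h2, ← h1]
    exact Finset.sum_congr rfl fun j _ => by simp [hW]
  have hmem : ∀ i < q, f^[i] x ∈ Set.Icc (c (i * p + b)) (c (i * p + b + 1)) := by
    intro i hi
    rcases Nat.eq_zero_or_pos i with rfl | hi0
    · rcases hb with rfl | rfl
      · simpa [hc0] using hc_le 0
      · simpa [hc0] using hc_le (-1)
    · have hsi := hs.iterate f.monotone hHf i
      exact ⟨(hc _).le hsi (by linarith [(hρ i hi0 hi).1]),
        hsi.le (hc _) (by linarith [(hρ i hi0 hi).2])⟩
  have hterm : ∀ i ∈ Finset.range q, |φ (f^[i] x) - q * I (i * p + b)| ≤ W (i * p + b) := by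
    intro i hi
    refine abs_sub_mul_integral_comp_le H.monotone hφ hg hq' ?_ (hmem i (Finset.mem_range.1 hi))
      fun u hu hu' => ⟨(hc _).2 u hu, (hc _).1 u hu'⟩
    push_cast
    field_simp
    ring
  rw [← hIsum, ← hWsum, ← sum_range_mul_add_of_periodic hq hIper hpq b,
    ← sum_range_mul_add_of_periodic hq hWper hpq b, birkhoffSum, Finset.mul_sum,
    ← Finset.sum_sub_distrib]
  exact (Finset.abs_sum_le_sum_abs _ _).trans (Finset.sum_le_sum hterm)

theorem hasDerivAt_iterate_prod {F F' : ℝ → ℝ} (hF' : ∀ x, HasDerivAt F (F' x) x) (n : ℕ) (x : ℝ) :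
    HasDerivAt F^[n] (∏ i ∈ Finset.range n, F' (F^[i] x)) x := by
  induction n with
  | zero => simpa using hasDerivAt_id x
  | succ n ih =>
    rw [Function.iterate_succ', Finset.prod_range_succ, mul_comm]
    exact (hF' _).comp x ih

theorem prod_eq_exp_birkhoffSum_log {F F' : ℝ → ℝ} (hF' : ∀ x, 0 < F' x) (n : ℕ) (x : ℝ) :
    ∏ i ∈ Finset.range n, F' (F^[i] x) = Real.exp (birkhoffSum F (fun y => Real.log (F' y)) n x) := by
  rw [birkhoffSum, Real.exp_sum]
  exact Finset.prod_congr rfl fun i _ => (Real.exp_log (hF' _)).symm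

theorem periodic_of_hasDerivAt_of_map_add {F F' : ℝ → ℝ} {c d : ℝ} (hF : ∀ x, F (x + c) = F x + d)
    (hF' : ∀ x, HasDerivAt F (F' x) x) : Function.Periodic F' c := fun x =>
  (((hF' (x + c)).comp_add_const x c).congr_of_eventuallyEq
    (Filter.Eventually.of_forall fun y => (hF y).symm)).unique ((hF' x).add_const d)

namespace CircleDeg1Lift

theorem iterate_add_int (f : CircleDeg1Lift) (n : ℕ) (x : ℝ) (m : ℤ) :
    f^[n] (x + m) = f^[n] x + m := by
  rw [← coe_pow, map_add_int]

theorem iterate_sub_int (f : CircleDeg1Lift) (n : ℕ) (x : ℝ) (m : ℤ) :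
    f^[n] (x - m) = f^[n] x - m := by
  rw [← coe_pow, map_sub_int]

theorem bddAbove_range_abs_iterate_sub (f : CircleDeg1Lift) (n : ℕ) (c : ℝ) :
    BddAbove (Set.range fun x => |f^[n] x - x - c|) := by
  refine ⟨|f^[n] 0| + 1 + |c|, ?_⟩
  rintro _ ⟨x, rfl⟩
  have h1 := (f ^ n).map_le_of_map_zero x
  have h2 := (f ^ n).le_map_of_map_zero x
  rw [coe_pow] at h1 h2
  have h3 := Int.ceil_lt_add_one x
  have h4 := Int.sub_one_lt_floor x
  have h5 : |f^[n] x - x| ≤ |f^[n] 0| + 1 := by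
    rw [abs_le]
    constructor <;> cases abs_cases (f^[n] 0) <;> linarith
  exact (abs_sub _ _).trans (by gcongr)

/-- The iterates of a circle map are ordered as those of the rotation by its rotation number. -/
theorem pos_mul_iterate_sub (f : CircleDeg1Lift) {n : ℕ} {m : ℤ} {ε : ℝ} (hε : ε = 1 ∨ ε = -1)
    (h : 0 < ε * (n * f.translationNumber - m)) (x : ℝ) : 0 < ε * (f^[n] x - x - m) := by
  rw [← translationNumber_pow] at h
  rw [← coe_pow]
  rcases hε with rfl | rfl
  · linarith [(f ^ n).lt_map_of_int_lt_translationNumber (by linarith) x]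
  · linarith [(f ^ n).map_lt_of_translationNumber_lt_int (by linarith) x]

theorem neg_displacement_lt_displacement (f : CircleDeg1Lift) {a a' : ℕ} {p p' : ℤ} {ε : ℝ}
    (hε : ε = 1 ∨ ε = -1)
    (h : 0 < ε * (a * f.translationNumber - p) + ε * (a' * f.translationNumber - p')) (x : ℝ) :
    -(ε * (f^[a'] x - x - p')) <
      ε * (f^[a] (f^[a'] x - p') - (f^[a'] x - p') - p) := by
  have := f.pos_mul_iterate_sub (n := a + a') (m := p + p') hε (by push_cast; linarith) x
  rw [Function.iterate_add_apply] at this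
  push_cast at this
  rw [iterate_sub_int]
  linarith

theorem one_add_mul_displacement_le (f : CircleDeg1Lift) {a a' : ℕ} {p p' : ℤ} {ε κ : ℝ}
    (hε : ε = 1 ∨ ε = -1) (ha : a ≤ 2 * a')
    (h0 : 0 < ε * (a' * f.translationNumber - p'))
    (h : 2 * (ε * (a' * f.translationNumber - p')) < ε * (a * f.translationNumber - p))
    (hκ : ∀ u w, u ≤ w → κ * (w - u) ≤ f^[a'] w - f^[a'] u) (x : ℝ) :
    (1 + κ) * (ε * (f^[a'] x - x - p')) ≤ ε * (f^[a] x - x - p) := by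
  have hshift : κ * (ε * (f^[a'] x - x - p')) ≤ ε * (f^[a'] (f^[a'] x) - f^[a'] x - p') := by
    have h1 := f.pos_mul_iterate_sub hε h0 x
    have h2 := f.iterate_sub_int a' (f^[a'] x) p'
    rcases hε with rfl | rfl
    · linarith [hκ x (f^[a'] x - p') (by linarith)]
    · linarith [hκ (f^[a'] x - p') x (by linarith)]
  have horder := f.pos_mul_iterate_sub (n := 2 * a' - a) (m := 2 * p' - p) (ε := -ε)
    (hε.symm.imp (by rintro rfl; simp) (by rintro rfl; simp))
    (by push_cast [Nat.cast_sub ha]; linarith) (f^[a] x)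
  rw [← Function.iterate_add_apply, Nat.sub_add_cancel ha, two_mul,
    Function.iterate_add_apply] at horder
  push_cast at horder
  linarith

/-- The Denjoy inequality: if `q n` are return times satisfying a Denjoy–Koksma bound for `log f'`,
then the derivatives of `f^[q n]` are bounded below. -/
theorem exp_neg_le_prod_of_abs_birkhoffSum_sub_le (f : CircleDeg1Lift) {f' : ℝ → ℝ}
    (hf' : ∀ x, HasDerivAt f (f' x) x) (hpos : ∀ x, 0 < f' x) {q : ℕ → ℕ}
    (hq : Filter.Tendsto q Filter.atTop Filter.atTop) {a v : ℝ}
    (h : ∀ n x, |birkhoffSum f (fun y => Real.log (f' y)) (q n) x - q n * a| ≤ v) (n : ℕ) (x : ℝ) :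
    Real.exp (-v) ≤ ∏ i ∈ Finset.range (q n), f' (f^[i] x) := by
  have hbound : ∀ n, q n * |a| ≤ v := by
    intro n
    obtain ⟨y, -, hy⟩ := exists_hasDerivAt_eq_slope f^[q n] _ zero_lt_one
      (fun z _ => (hasDerivAt_iterate_prod hf' (q n) z).continuousAt.continuousWithinAt)
      (fun z _ => hasDerivAt_iterate_prod hf' (q n) z)
    have h1 := f.iterate_add_int (q n) 0 1
    rw [Int.cast_one, zero_add] at h1
    rw [h1, prod_eq_exp_birkhoffSum_log hpos] at hy
    have h2 : birkhoffSum f (fun y => Real.log (f' y)) (q n) y = 0 := by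
      rw [← Real.exp_eq_one_iff, hy]
      norm_num
    simpa [h2, abs_mul] using h n y
  have ha : a = 0 := by
    by_contra ha
    have := ((tendsto_natCast_atTop_atTop (R := ℝ)).comp hq).atTop_mul_const (abs_pos.2 ha)
    obtain ⟨m, hm⟩ := (this.eventually_gt_atTop v).exists
    exact (hbound m).not_gt hm
  rw [prod_eq_exp_birkhoffSum_log hpos, Real.exp_le_exp]
  have := h n x
  rw [ha, mul_zero, sub_zero] at this
  exact (abs_le.1 this).1

end CircleDeg1Lift

section Convergents

variable {k p q : ℕ → ℕ}

theorem convergents_det (hp0 : p 0 = 0) (hp1 : p 1 = 1) (hq0 : q 0 = 1)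
    (hprec : ∀ n, p (n + 2) = k (n + 2) * p (n + 1) + p n)
    (hqrec : ∀ n, q (n + 2) = k (n + 2) * q (n + 1) + q n) (n : ℕ) :
    (p (n + 1) * q n - p n * q (n + 1) : ℤ) = (-1) ^ n := by
  induction n with
  | zero => simp [hp0, hp1, hq0]
  | succ n ih =>
    rw [hprec, hqrec, pow_succ, ← ih]
    push_cast
    ring

theorem convergents_denom_pos_and_le (hk : ∀ n, 1 ≤ k (n + 1)) (hq0 : q 0 = 1) (hq1 : q 1 = k 1)
    (hqrec : ∀ n, q (n + 2) = k (n + 2) * q (n + 1) + q n) (n : ℕ) :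
    0 < q n ∧ q n ≤ q (n + 1) := by
  induction n with
  | zero => exact ⟨by omega, by have := hk 0; rw [zero_add] at this ⊢; omega⟩
  | succ n ih =>
    have := Nat.le_mul_of_pos_left (q (n + 1)) (show 0 < k (n + 2) from hk (n + 1))
    have := hqrec n
    rw [show n + 1 + 1 = n + 2 from rfl]
    omega

theorem le_convergents_denom (hk : ∀ n, 1 ≤ k (n + 1)) (hq0 : q 0 = 1) (hq1 : q 1 = k 1)
    (hqrec : ∀ n, q (n + 2) = k (n + 2) * q (n + 1) + q n) (n : ℕ) : n ≤ q (n + 1) := by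
  induction n with
  | zero => simp
  | succ n ih =>
    have := Nat.le_mul_of_pos_left (q (n + 1)) (show 0 < k (n + 2) from hk (n + 1))
    have := hqrec n
    rw [show n + 1 + 1 = n + 2 from rfl]
    have := convergents_denom_pos_and_le hk hq0 hq1 hqrec n
    omega

theorem convergents_alternating_error_pos (hk : ∀ n, 1 ≤ k (n + 1)) (hp0 : p 0 = 0) (hp1 : p 1 = 1)
    (hq0 : q 0 = 1) (hq1 : q 1 = k 1) (hprec : ∀ n, p (n + 2) = k (n + 2) * p (n + 1) + p n)
    (hqrec : ∀ n, q (n + 2) = k (n + 2) * q (n + 1) + q n) {ρ : ℝ}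
    (hconv : Filter.Tendsto (fun n => (p n : ℝ) / (q n : ℝ)) Filter.atTop (nhds ρ)) (n : ℕ) :
    0 < (-1) ^ n * (q n * ρ - p n) := by
  have hqpos : ∀ n, (0 : ℝ) < q n := fun n => by
    exact_mod_cast (convergents_denom_pos_and_le hk hq0 hq1 hqrec n).1
  set u : ℕ → ℝ := fun j => (-1) ^ n * (ρ - p (n + 2 * j) / q (n + 2 * j)) with hu
  have hanti : StrictAnti u := by
    refine strictAnti_nat_of_succ_lt fun j => ?_
    have hdet : (p (n + 2 * j + 1) * q (n + 2 * j) - p (n + 2 * j) * q (n + 2 * j + 1) : ℝ)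
        = (-1) ^ n := by
      have := convergents_det hp0 hp1 hq0 hprec hqrec (n + 2 * j)
      rw [pow_add, pow_mul, neg_one_sq, one_pow, mul_one] at this
      exact_mod_cast this
    have hdiff : u j - u (j + 1) =
        k (n + 2 * j + 2) / (q (n + 2 * j) * q (n + 2 * j + 2)) := by
      have h1 := hqpos (n + 2 * j)
      have h2 := hqpos (n + 2 * j + 2)
      have hpr : (p (n + 2 * j + 2) : ℝ) = k (n + 2 * j + 2) * p (n + 2 * j + 1) + p (n + 2 * j) := by
        exact_mod_cast hprec _
      have hqr : (q (n + 2 * j + 2) : ℝ) = k (n + 2 * j + 2) * q (n + 2 * j + 1) + q (n + 2 * j) := by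
        exact_mod_cast hqrec _
      have hsq : ((-1 : ℝ) ^ n) * (-1) ^ n = 1 := by rw [← mul_pow]; simp
      have h3 : u j - u (j + 1) = (-1) ^ n *
          ((p (n + 2 * j + 2) * q (n + 2 * j) - p (n + 2 * j) * q (n + 2 * j + 2)) /
            (q (n + 2 * j) * q (n + 2 * j + 2))) := by
        simp only [hu, show n + 2 * (j + 1) = n + 2 * j + 2 by ring]
        field_simp
        ring
      have h4 : (p (n + 2 * j + 2) * q (n + 2 * j) - p (n + 2 * j) * q (n + 2 * j + 2) : ℝ)
          = k (n + 2 * j + 2) * (-1) ^ n := by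
        rw [hpr, hqr, ← hdet]; ring
      rw [h3, h4, ← mul_div_assoc, mul_left_comm, hsq, mul_one]
    have : 0 < u j - u (j + 1) := by
      rw [hdiff]
      have := hqpos (n + 2 * j)
      have := hqpos (n + 2 * j + 2)
      have : (0 : ℝ) < k (n + 2 * j + 2) := by exact_mod_cast hk (n + 2 * j + 1)
      positivity
    linarith
  have hlim : Filter.Tendsto u Filter.atTop (nhds 0) := by
    have h1 : Filter.Tendsto (fun j => n + 2 * j) Filter.atTop Filter.atTop :=
      Filter.tendsto_atTop_mono (fun j => by simp only [id]; omega) Filter.tendsto_id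
    simpa using ((hconv.comp h1).const_sub ρ).const_mul ((-1 : ℝ) ^ n)
  have hu0 : 0 < u 0 := (hanti.antitone.le_of_tendsto hlim 1).trans_lt (hanti zero_lt_one)
  have := mul_pos (hqpos n) hu0
  have hne := (hqpos n).ne'
  simp only [hu, mul_zero, add_zero] at this
  convert! this using 1
  field_simp

end Convergents

theorem convergent_grid_bounds {p q i : ℕ} {ρ : ℝ} {n : ℕ} (hq : 0 < q) (hi0 : 0 < i) (hi : i < q)
    (h0 : 0 < (-1) ^ n * (q * ρ - p)) (h1 : q * ((-1) ^ n * (q * ρ - p)) < 1) {b : ℤ}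
    (hb : b = if Even n then 0 else -1) :
    ((i * p + b : ℤ) : ℝ) / q < i * ρ ∧ i * ρ < ((i * p + b + 1 : ℤ) : ℝ) / q := by
  have hq' : (0 : ℝ) < q := by exact_mod_cast hq
  have hi' : (i : ℝ) < q := by exact_mod_cast hi
  have hi0' : (0 : ℝ) < i := by exact_mod_cast hi0
  rw [div_lt_iff₀ hq', lt_div_iff₀ hq']
  have h2 := mul_pos hi0' h0
  have h3 := (mul_lt_mul_of_pos_right hi' h0).trans h1
  rcases Nat.even_or_odd n with hn | hn
  · rw [if_pos hn] at hb
    rw [hn.neg_one_pow] at h2 h3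
    subst hb
    push_cast
    constructor <;> linarith
  · rw [if_neg (Nat.not_even_iff_odd.2 hn)] at hb
    rw [hn.neg_one_pow] at h2 h3
    subst hb
    push_cast
    constructor <;> linarith

theorem le_pow_mul_of_antitone_of_two_step {l : ℕ → ℝ} {c : ℝ} (hc0 : 0 < c) (hc1 : c ≤ 1)
    (hl : ∀ n, 0 ≤ l n) (h1 : ∀ n, l (n + 1) ≤ l n) (h2 : ∀ n, l (n + 2) ≤ c ^ 2 * l n) (n m : ℕ) :
    l (n + m) ≤ 1 / c * c ^ m * l n := by
  induction m using Nat.twoStepInduction with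
  | zero =>
    have : 1 ≤ 1 / c := by rwa [le_div_iff₀ hc0, one_mul]
    simpa using mul_le_mul_of_nonneg_right this (hl n)
  | one =>
    rw [pow_one, one_div_mul_cancel hc0.ne', one_mul]
    exact h1 n
  | more m ih _ =>
    calc l (n + m + 2) ≤ c ^ 2 * l (n + m) := h2 _
      _ ≤ c ^ 2 * (1 / c * c ^ m * l n) := by gcongr
      _ = 1 / c * c ^ (m + 2) * l n := by ring


/-- Exponential decay of the lengths of fundamental segments:
`l_{n+m} ≤ C λᵐ lₙ` with `λ = 1/√(1+e^{−𝒞}) ∈ (1/2,1)`,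
`𝒞 = ∫₀¹ |F″/F′|` the variation of `log F′` over one period. -/
theorem l_exponential_decay
    (F F' F'' : ℝ → ℝ) (hF : StrictMono F) (hFp : ∀ x, F (x + 1) = F x + 1)
    (hF' : ∀ x, HasDerivAt F (F' x) x) (hF'' : ∀ x, HasDerivAt F' (F'' x) x)
    (hF''cont : Continuous F'') (hF'pos : ∀ x, 0 < F' x)
    (ρ : ℝ) (hρ : ρ ∈ Set.Ioo (0:ℝ) 1) (hirr : Irrational ρ)
    (hrot : ∀ x : ℝ,
      Filter.Tendsto (fun n : ℕ => (F^[n] x - x) / (n : ℝ)) Filter.atTop (nhds ρ))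
    (k p q : ℕ → ℕ) (hk : ∀ n, 1 ≤ k (n + 1))
    (hp0 : p 0 = 0) (hp1 : p 1 = 1) (hq0 : q 0 = 1) (hq1 : q 1 = k 1)
    (hprec : ∀ n, p (n + 2) = k (n + 2) * p (n + 1) + p n)
    (hqrec : ∀ n, q (n + 2) = k (n + 2) * q (n + 1) + q n)
    (hconv : Filter.Tendsto (fun n => (p n : ℝ) / (q n : ℝ)) Filter.atTop (nhds ρ))
    (l : ℕ → ℝ) (hl : ∀ n, l n = ⨆ x : ℝ, |F^[q n] x - x - (p n : ℝ)|)
    (lam : ℝ)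
    (hlam : lam = 1 / Real.sqrt (1 + Real.exp (-(∫ x in (0:ℝ)..1, |F'' x / F' x|)))) :
    lam ∈ Set.Ioo (1/2 : ℝ) 1 ∧
      ∃ C > 0, ∀ n m : ℕ, l (n + m) ≤ C * lam ^ m * l n := by
  set v : ℝ := ∫ x in (0:ℝ)..1, |F'' x / F' x| with hv
  have hv0 : 0 ≤ v := intervalIntegral.integral_nonneg zero_le_one fun _ _ => abs_nonneg _
  have hκ0 : 0 < Real.exp (-v) := Real.exp_pos _
  have hκ1 : Real.exp (-v) ≤ 1 := Real.exp_le_one_iff.2 (by linarith)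
  have hlam0 : 0 < lam := by rw [hlam]; positivity
  have hlam_sq : lam ^ 2 = 1 / (1 + Real.exp (-v)) := by
    rw [hlam, div_pow, Real.sq_sqrt (by positivity), one_pow]
  have hlam1 : lam < 1 := by
    rw [← sq_lt_one_iff₀ hlam0.le, hlam_sq, div_lt_one (by positivity)]
    linarith
  have hlam_half : 1 / 2 < lam := by
    refine lt_of_pow_lt_pow_left₀ 2 hlam0.le ?_
    rw [hlam_sq]
    exact (by norm_num : (1 / 2 : ℝ) ^ 2 < 1 / 2).trans_le
      (one_div_le_one_div_of_le (by positivity) (by linarith))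
  refine ⟨⟨hlam_half, hlam1⟩, 1 / lam, by positivity, ?_⟩
  -- the circle map, its rotation number and a semiconjugacy from the rotation
  let f : CircleDeg1Lift := ⟨⟨F, hF.monotone⟩, hFp⟩
  have hf : ⇑f = F := rfl
  have hτ : f.translationNumber = ρ := tendsto_nhds_unique
    ((f.tendsto_translationNumber 0).congr fun n => by rw [CircleDeg1Lift.coe_pow, hf]) (hrot 0)
  have hFcont : Continuous F := continuous_iff_continuousAt.2 fun x => (hF' x).continuousAt
  obtain ⟨H, hH⟩ : ∃ H : CircleDeg1Lift, ∀ t, H (t + ρ) = F (H t) := by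
    obtain ⟨H, hH⟩ := CircleDeg1Lift.semiconj_of_bijective_of_translationNumber_eq
      (f₁ := CircleDeg1Lift.translate (Multiplicative.ofAdd ρ)) (f₂ := f)
      (CircleDeg1Lift.isUnit_iff_bijective.1 (Units.isUnit _))
      ⟨hF.injective, f.continuous_iff_surjective.1 hFcont⟩
      (by rw [CircleDeg1Lift.translationNumber_translate, hτ])
    refine ⟨H, fun t => ?_⟩
    have := hH t
    rwa [CircleDeg1Lift.translate_apply, add_comm] at this
  -- arithmetic of the convergents
  have hqmono := convergents_denom_pos_and_le hk hq0 hq1 hqrec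
  have hdet := convergents_det hp0 hp1 hq0 hprec hqrec
  set s : ℕ → ℝ := fun n => (-1) ^ n * (q n * ρ - p n) with hs
  have hspos : ∀ n, 0 < s n :=
    convergents_alternating_error_pos hk hp0 hp1 hq0 hq1 hprec hqrec hconv
  have hsrec : ∀ n, s n = k (n + 2) * s (n + 1) + s (n + 2) := fun n => by
    simp only [hs, hprec, hqrec]
    push_cast
    ring
  have hsadd : ∀ n, s (n + 1) + s (n + 2) ≤ s n := fun n => by
    have h : (1 : ℝ) ≤ k (n + 2) := by exact_mod_cast hk (n + 1)
    rw [hsrec n]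
    gcongr
    exact le_mul_of_one_le_left (hspos _).le h
  have hslt : ∀ n, s (n + 1) < s n := fun n => by linarith [hsadd n, hspos (n + 2)]
  have hqs : ∀ n, q n * s n < 1 := fun n => by
    have h1 : q (n + 1) * s n + q n * s (n + 1) = 1 := by
      have h : (p (n + 1) * q n - p n * q (n + 1) : ℝ) = (-1) ^ n := by exact_mod_cast hdet n
      have hsq : ((-1 : ℝ) ^ n) * (-1) ^ n = 1 := by rw [← mul_pow]; simp
      simp only [hs]
      linear_combination (-1) ^ n * h + hsq
    have h2 : (q n : ℝ) ≤ q (n + 1) := by exact_mod_cast (hqmono n).2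
    have h3 : (0 : ℝ) < q n := by exact_mod_cast (hqmono n).1
    nlinarith [mul_pos h3 (hspos (n + 1)), mul_le_mul_of_nonneg_right h2 (hspos n).le]
  have hcop : ∀ n, IsCoprime (p n : ℤ) (q n : ℤ) := fun n => by
    have hsq : ((-1 : ℤ) ^ n) * (-1) ^ n = 1 := by rw [← mul_pow]; simp
    exact ⟨-(-1) ^ n * q (n + 1), (-1) ^ n * p (n + 1), by
      linear_combination (-1) ^ n * hdet n + hsq⟩
  have hqtop : Filter.Tendsto q Filter.atTop Filter.atTop :=
    (Filter.tendsto_add_atTop_iff_nat 1).1 <|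
      Filter.tendsto_atTop_mono (le_convergents_denom hk hq0 hq1 hqrec) Filter.tendsto_id
  -- distortion estimates
  have hF'per : Function.Periodic F' 1 := periodic_of_hasDerivAt_of_map_add hFp hF'
  have hF''per : Function.Periodic F'' 1 :=
    periodic_of_hasDerivAt_of_map_add (d := 0) (fun x => by rw [hF'per, add_zero]) hF''
  have hF'cont : Continuous F' := continuous_iff_continuousAt.2 fun x => (hF'' x).continuousAt
  have hprod : ∀ n x, Real.exp (-v) ≤ ∏ i ∈ Finset.range (q n), F' (F^[i] x) := by
    refine f.exp_neg_le_prod_of_abs_birkhoffSum_sub_le hF' hF'pos hqtop fun n x =>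
      f.abs_birkhoffSum_sub_le H hH (fun x => (hF'' x).log (hF'pos x).ne')
        (hF''cont.div hF'cont fun x => (hF'pos x).ne') (fun x => by simp only [hF'per x])
        (fun x => by simp only [hF'per x, hF''per x]) (hqmono n).1 (hcop n)
        (b := if Even n then 0 else -1) (by split_ifs <;> simp)
        (fun i hi0 hi => ?_) x
    simpa using convergent_grid_bounds (hqmono n).1 hi0 hi (hspos n) (hqs n) rfl
  have hexpand : ∀ n u w, u ≤ w → Real.exp (-v) * (w - u) ≤ F^[q n] w - F^[q n] u :=
    fun n u w huw => by
      have hd := hasDerivAt_iterate_prod hF' (q n)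
      exact mul_sub_le_image_sub_of_le_deriv (fun x => (hd x).differentiableAt)
        (fun x => (hd x).deriv ▸ hprod n x) huw
  -- displacements and their suprema
  have hε : ∀ n, ((-1 : ℝ) ^ n = 1 ∨ (-1 : ℝ) ^ n = -1) := neg_one_pow_eq_or ℝ
  have hτs : ∀ n, (-1) ^ n * (q n * f.translationNumber - (p n : ℤ)) = s n := fun n => by
    simp [hs, hτ]
  have habs : ∀ n x, |F^[q n] x - x - p n| = (-1) ^ n * (F^[q n] x - x - p n) := fun n x => by
    have h := f.pos_mul_iterate_sub (hε n) ((hτs n).symm ▸ hspos n) x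
    rw [Int.cast_natCast, hf] at h
    rw [← abs_of_pos h, abs_mul, abs_neg_one_pow, one_mul]
  have hle : ∀ n x, |F^[q n] x - x - p n| ≤ l n := fun n x => by
    rw [hl]
    exact le_ciSup (f.bddAbove_range_abs_iterate_sub (q n) (p n)) x
  refine le_pow_mul_of_antitone_of_two_step hlam0 hlam1.le
    (fun n => (abs_nonneg _).trans (hle n 0)) (fun n => ?_) (fun n => ?_)
  · rw [hl (n + 1)]
    refine ciSup_le fun x => ?_
    have h := f.neg_displacement_lt_displacement (a := q n) (a' := q (n + 1)) (p := p n)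
      (p' := p (n + 1)) (hε n) (by
        have h1 := hτs (n + 1)
        rw [pow_succ] at h1
        linarith [hτs n, hslt n]) x
    have h2 := habs n (F^[q (n + 1)] x - (p (n + 1) : ℤ))
    rw [habs, pow_succ]
    have h3 := hle n (F^[q (n + 1)] x - (p (n + 1) : ℤ))
    simp only [Int.cast_natCast, hf] at h h2 h3
    rw [h2] at h3
    linarith
  · rw [hl (n + 2), hlam_sq]
    refine ciSup_le fun x => ?_
    have hq2 : q n ≤ 2 * q (n + 2) := by
      have := (hqmono n).2
      have : q (n + 1) ≤ q (n + 2) := (hqmono (n + 1)).2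
      omega
    have hpow : (-1 : ℝ) ^ (n + 2) = (-1) ^ n := by ring
    have h2 := hτs (n + 2)
    rw [hpow] at h2
    have h := f.one_add_mul_displacement_le (p := p n) (p' := p (n + 2)) (hε n) hq2
      (by rw [h2]; exact hspos _)
      (by rw [h2, hτs]; linarith [hsadd n, hslt (n + 1)]) (hexpand (n + 2)) x
    simp only [Int.cast_natCast, hf] at h
    rw [← habs n, ← hpow, ← habs (n + 2)] at h
    rw [one_div_mul_eq_div, le_div_iff₀ (by positivity), mul_comm]
    exact h.trans (hle n x)
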